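/- Let D be a byte pair dictionary, and let v, w be strings with 𝕋_hf^D(v) = τ₁⌢u⌢τ₂ and 𝕋_hf^D(w) = φ₁⌢u⌢φ₂ for the same token u and (possibly empty) tokenizations τ₁, τ₂, φ₁, φ₂. Then 𝕋_hf^D(π(τ₁⌢u⌢φ₂)) = τ₁⌢u⌢φ₂ and 𝕋_hf^D(π(φ₁⌢u⌢τ₂)) = φ₁⌢u⌢τ₂. -/

import Mathlib

/-!
Formalization of byte pair encoding (BPE) tokenization semantics.

* The alphabet is a type `α`.
* A *token* is a (intended nonempty) string over `α`, i.e. a `List α`.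
* A *tokenization* is a finite sequence of tokens.
* A *byte pair dictionary* is a finite sequence of rules (pairs of tokens),
  listed in order of decreasing priority.
-/

/-- A token: a string over the alphabet `α`. -/
abbrev Token (α : Type*) := List α

/-- A tokenization: a finite sequence of tokens. -/
abbrev Tok (α : Type*) := List (Token α)

/-- A byte pair dictionary: a finite sequence of rules, in decreasing priority order. -/
abbrev Dict (α : Type*) := List (Token α × Token α)

variable {α : Type*}

/-- `π`: concatenation of the tokens of a tokenization. -/
def pi (τ : Tok α) : List α := τ.flatten

/-- All tokens of a tokenization are nonempty strings. -/
def NETok (τ : Tok α) : Prop := ∀ u ∈ τ, u ≠ []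

/-- All rules of a dictionary consist of nonempty tokens. -/
def NEDict (D : Dict α) : Prop := ∀ r ∈ D, r.1 ≠ [] ∧ r.2 ≠ []

/-- `Tk∅(w)`: the initial tokenization of `w` into single symbols. -/
def TkEmpty (w : List α) : Tok α := w.map (fun a => [a])

/-- Rule `r` applies in tokenization `τ` at position `p`
(i.e. `τ = φ ⌢ r.1 ⌢ r.2 ⌢ φ'` with `|φ| = p`). -/
def AppliesAt (r : Token α × Token α) (τ : Tok α) (p : ℕ) : Prop :=
  ∃ φ φ' : Tok α, φ.length = p ∧ τ = φ ++ r.1 :: r.2 :: φ'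

/-- Rule `r` applies somewhere in tokenization `τ`. -/
def Applies (r : Token α × Token α) (τ : Tok α) : Prop := ∃ p, AppliesAt r τ p

/-- The result of applying (merging by) rule `r` at position `p` in `τ`. -/
def applyAt (r : Token α × Token α) (τ : Tok α) (p : ℕ) : Tok α :=
  τ.take p ++ (r.1 ++ r.2) :: τ.drop (p + 2)

/-- The base (nondeterministic) rewriting step `τ ⇒ τ'`: some rule of `D`
is applied somewhere in `τ`. -/
def BStep (D : Dict α) (τ τ' : Tok α) : Prop :=
  ∃ (φ φ' : Tok α) (u v : Token α),
    (u, v) ∈ D ∧ τ = φ ++ u :: v :: φ' ∧ τ' = φ ++ (u ++ v) :: φ'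

/-- `τ` is a base tokenization of `w`: reachable from `Tk∅(w)` by base steps,
and no rule of `D` applies to it. -/
def IsBase (D : Dict α) (w : List α) (τ : Tok α) : Prop :=
  Relation.ReflTransGen (BStep D) (TkEmpty w) τ ∧ ∀ τ', ¬ BStep D τ τ'

/-- `BStepN D n τ τ'`: `τ'` is obtained from `τ` by exactly `n` base steps. -/
def BStepN (D : Dict α) : ℕ → Tok α → Tok α → Prop
  | 0 => Eq
  | n + 1 => fun τ τ'' => ∃ τ', BStepN D n τ τ' ∧ BStep D τ' τ''

/-- One SentencePiece step applying the rule of index `i` (highest priority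
applicable) at position `p` (leftmost occurrence of that rule). -/
def SPStepAt (D : Dict α) (i p : ℕ) (τ τ' : Tok α) : Prop :=
  ∃ h : i < D.length,
    AppliesAt (D[i]'h) τ p ∧
    (∀ (j : ℕ) (hj : j < D.length), j < i → ¬ Applies (D[j]'hj) τ) ∧
    (∀ q < p, ¬ AppliesAt (D[i]'h) τ q) ∧
    τ' = applyAt (D[i]'h) τ p

/-- One SentencePiece step: the highest priority applicable rule is applied
at its leftmost occurrence. -/
def SPStep (D : Dict α) (τ τ' : Tok α) : Prop := ∃ i p, SPStepAt D i p τ τ'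

/-- One SentencePiece step which applies the rule `r` of `D`. -/
def SPStepRule (D : Dict α) (r : Token α × Token α) (τ τ' : Tok α) : Prop :=
  ∃ (i p : ℕ) (h : i < D.length), D[i]'h = r ∧ SPStepAt D i p τ τ'

/-- `τ` is the SentencePiece tokenization `𝕋^D(w)` of `w`: reachable from
`Tk∅(w)` by SentencePiece steps, and no further step applies. -/
def IsSP (D : Dict α) (w : List α) (τ : Tok α) : Prop :=
  Relation.ReflTransGen (SPStep D) (TkEmpty w) τ ∧ ∀ τ', ¬ SPStep D τ τ'

/-- One application of rule `r` at its leftmost occurrence. -/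
def LeftStep (r : Token α × Token α) (τ τ' : Tok α) : Prop :=
  ∃ p, AppliesAt r τ p ∧ (∀ q < p, ¬ AppliesAt r τ q) ∧ τ' = applyAt r τ p

/-- Exhaustive application of rule `r`, leftmost first, until it no longer applies. -/
def Exhaust (r : Token α × Token α) (τ τ' : Tok α) : Prop :=
  Relation.ReflTransGen (LeftStep r) τ τ' ∧ ¬ Applies r τ'

/-- One HuggingFace (macro) step using the rule of index `i`: the rule of
index `i` is the highest-priority applicable rule, and it is applied
repeatedly at its leftmost occurrence until it no longer applies. -/
def HFStepAt (D : Dict α) (i : ℕ) (τ τ' : Tok α) : Prop :=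
  ∃ h : i < D.length,
    Applies (D[i]'h) τ ∧
    (∀ (j : ℕ) (hj : j < D.length), j < i → ¬ Applies (D[j]'hj) τ) ∧
    Exhaust (D[i]'h) τ τ'

/-- One HuggingFace (macro) step. -/
def HFStep (D : Dict α) (τ τ' : Tok α) : Prop := ∃ i, HFStepAt D i τ τ'

/-- One HuggingFace (macro) step which uses the rule `r` of `D`. -/
def HFStepRule (D : Dict α) (r : Token α × Token α) (τ τ' : Tok α) : Prop :=
  ∃ (i : ℕ) (h : i < D.length), D[i]'h = r ∧ HFStepAt D i τ τ'

/-- `τ` is the HuggingFace tokenization `𝕋_hf^D(w)` of `w`. -/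
def IsHF (D : Dict α) (w : List α) (τ : Tok α) : Prop :=
  Relation.ReflTransGen (HFStep D) (TkEmpty w) τ ∧ ∀ τ', ¬ HFStep D τ τ'

/-- A dictionary is *proper* if each side of each rule of length `> 1` is
produced by some higher-priority rule. -/
def Proper (D : Dict α) : Prop :=
  ∀ (j : ℕ) (hj : j < D.length),
    (1 < (D[j]'hj).1.length →
      ∃ (i : ℕ) (hi : i < D.length), i < j ∧ (D[j]'hj).1 = (D[i]'hi).1 ++ (D[i]'hi).2) ∧
    (1 < (D[j]'hj).2.length →
      ∃ (i : ℕ) (hi : i < D.length), i < j ∧ (D[j]'hj).2 = (D[i]'hi).1 ++ (D[i]'hi).2)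

/-- `max{|uv| : u⌢v ∈ D}`: the maximal total length of a rule of `D`. -/
def maxPairLen (D : Dict α) : ℕ := (D.map (fun r => (r.1 ++ r.2).length)).foldr max 0

/-- `l` is a sufficient lookahead bound for `D`: whenever `𝕋^D(π(φ)π(τ)) = φ⌢τ` with
`|π(τ)| ≥ l`, appending any further text keeps `φ` as a prefix of the tokenization. -/
def GoodLookahead (D : Dict α) (l : ℕ) : Prop :=
  ∀ φ τ ψ : Tok α, l ≤ (pi τ).length →
    IsSP D (pi φ ++ pi τ) (φ ++ τ) →
    ∃ ψ', IsSP D (pi φ ++ pi τ ++ pi ψ) (φ ++ ψ')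

/-- The lookahead constant `l(D)`: the smallest sufficient lookahead bound. -/
noncomputable def lookaheadConst (D : Dict α) : ℕ := sInf {l | GoodLookahead D l}

open Classical in
/-- A single left-to-right pass merging the non-overlapping occurrences of the rule `r`. -/
noncomputable def mergePass (r : Token α × Token α) : Tok α → Tok α
  | x :: y :: t =>
    if x = r.1 ∧ y = r.2 then (r.1 ++ r.2) :: mergePass r t else x :: mergePass r (y :: t)
  | [x] => [x]
  | [] => []

section MergePass

variable {r : Token α × Token α}

theorem applies_iff_infix {τ : Tok α} : Applies r τ ↔ [r.1, r.2] <:+: τ := by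
  constructor
  · rintro ⟨_, φ, φ', -, h⟩
    exact ⟨φ, φ', by simp [h]⟩
  · rintro ⟨φ, φ', h⟩
    exact ⟨_, φ, φ', rfl, by simp [← h]⟩

theorem Applies.mono {τ τ' : Tok α} (h : Applies r τ) (hτ : τ <:+: τ') : Applies r τ' :=
  applies_iff_infix.2 ((applies_iff_infix.1 h).trans hτ)

theorem applies_cons_cons {x y : Token α} {t : Tok α} :
    Applies r (x :: y :: t) ↔ (x = r.1 ∧ y = r.2) ∨ Applies r (y :: t) := by
  simp only [applies_iff_infix]
  rw [List.infix_cons_iff]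
  simp [List.cons_prefix_cons, eq_comm]

theorem mergePass_cons_cons_of_eq (t : Tok α) :
    mergePass r (r.1 :: r.2 :: t) = (r.1 ++ r.2) :: mergePass r t := by
  simp [mergePass]

theorem mergePass_cons_cons_of_ne {x y : Token α} (t : Tok α) (h : ¬ (x = r.1 ∧ y = r.2)) :
    mergePass r (x :: y :: t) = x :: mergePass r (y :: t) := by
  rw [mergePass, if_neg h]

theorem mergePass_of_not_applies {τ : Tok α} (h : ¬ Applies r τ) : mergePass r τ = τ := by
  fun_induction mergePass r τ with
  | case1 x y t hxy ih => exact absurd (applies_cons_cons.2 (.inl hxy)) h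
  | case2 x y t hxy ih => rw [ih fun h' => h (applies_cons_cons.2 (.inr h'))]
  | case3 => rfl
  | case4 => rfl

theorem length_mergePass_le (τ : Tok α) : (mergePass r τ).length ≤ τ.length := by
  fun_induction mergePass r τ <;> simp_all; omega

theorem length_mergePass_lt {τ : Tok α} (h : Applies r τ) :
    (mergePass r τ).length < τ.length := by
  fun_induction mergePass r τ with
  | case1 x y t hxy ih =>
    have := length_mergePass_le (r := r) t
    simp only [List.length_cons]; omega
  | case2 x y t hxy ih =>
    have := ih ((applies_cons_cons.1 h).resolve_left hxy)
    simp only [List.length_cons] at this ⊢; omega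
  | case3 => simpa using (applies_iff_infix.1 h).length_le
  | case4 => simpa using (applies_iff_infix.1 h).length_le

theorem pi_mergePass (τ : Tok α) : pi (mergePass r τ) = pi τ := by
  fun_induction mergePass r τ <;> simp_all [pi]

theorem mergePass_eq_nil {τ : Tok α} : mergePass r τ = [] ↔ τ = [] := by
  fun_induction mergePass r τ <;> simp

/-- A splitting of the result of a pass lifts to a splitting of its input. -/
theorem exists_append_of_mergePass_eq_append {τ P Q : Tok α} (h : mergePass r τ = P ++ Q) :
    ∃ A B, τ = A ++ B ∧ mergePass r A = P ∧ mergePass r B = Q := by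
  rcases P with _ | ⟨p, P⟩
  · exact ⟨[], τ, rfl, by simp [mergePass], h⟩
  fun_induction mergePass r τ generalizing p P with
  | case1 x y t hxy ih =>
    obtain ⟨rfl, rfl⟩ := hxy
    obtain ⟨rfl, hP⟩ := List.cons_eq_cons.1 (h.trans List.cons_append)
    rcases P with _ | ⟨p, P⟩
    · exact ⟨[r.1, r.2], t, rfl, by simp [mergePass], hP⟩
    · obtain ⟨A, B, rfl, hA, hB⟩ := ih p P hP
      exact ⟨r.1 :: r.2 :: A, B, rfl, by rw [mergePass_cons_cons_of_eq, hA], hB⟩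
  | case2 x y t hxy ih =>
    obtain ⟨rfl, hP⟩ := List.cons_eq_cons.1 (h.trans List.cons_append)
    rcases P with _ | ⟨p, P⟩
    · exact ⟨[x], y :: t, rfl, by simp [mergePass], hP⟩
    · obtain ⟨A, B, hAB, hA, hB⟩ := ih p P hP
      rcases A with _ | ⟨a, A⟩
      · simp [mergePass] at hA
      · obtain ⟨rfl, rfl⟩ := List.cons_eq_cons.1 hAB
        exact ⟨x :: y :: A, B, rfl, by rw [mergePass_cons_cons_of_ne _ hxy, hA], hB⟩
  | case3 x =>
    obtain ⟨rfl, hP⟩ := List.cons_eq_cons.1 (h.trans List.cons_append)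
    obtain ⟨rfl, rfl⟩ := List.append_eq_nil_iff.1 hP.symm
    exact ⟨[x], [], rfl, by simp [mergePass], by simp [mergePass]⟩
  | case4 => simp at h

/-- If a pass respects the boundaries `A | U` and `U | B` separately, it respects both at once. -/
theorem mergePass_append_append (hr : r.2 ≠ []) {A U B : Tok α} (hU : U ≠ [])
    (hAU : mergePass r (A ++ U) = mergePass r A ++ mergePass r U)
    (hUB : mergePass r (U ++ B) = mergePass r U ++ mergePass r B) :
    mergePass r (A ++ U ++ B) = mergePass r A ++ mergePass r U ++ mergePass r B := by
  fun_induction mergePass r A with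
  | case1 x y t hxy ih =>
    obtain ⟨rfl, rfl⟩ := hxy
    simp only [List.cons_append, mergePass_cons_cons_of_eq, List.cons.injEq, true_and] at hAU ⊢
    exact ih hAU
  | case2 x y t hxy ih =>
    simp only [List.cons_append, mergePass_cons_cons_of_ne _ hxy, List.cons.injEq, true_and]
      at hAU ih ⊢
    exact ih hAU
  | case3 x =>
    obtain ⟨y, t, rfl⟩ := List.exists_cons_of_ne_nil hU
    by_cases hxy : x = r.1 ∧ y = r.2
    · obtain ⟨rfl, rfl⟩ := hxy
      simp [mergePass_cons_cons_of_eq, hr] at hAU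
    · simp only [List.cons_append, List.nil_append, mergePass_cons_cons_of_ne _ hxy] at hUB ⊢
      rw [hUB]
  | case4 => simpa using hUB

theorem mergePass_leftmost_merge (h1 : r.1 ≠ []) (h2 : r.2 ≠ []) (φ φ' : Tok α)
    (h : ∀ q < φ.length, ¬ AppliesAt r (φ ++ r.1 :: r.2 :: φ') q) :
    mergePass r (φ ++ (r.1 ++ r.2) :: φ') = mergePass r (φ ++ r.1 :: r.2 :: φ') := by
  induction φ with
  | nil =>
    rw [List.nil_append, List.nil_append, mergePass_cons_cons_of_eq]
    rcases φ' with _ | ⟨y, t⟩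
    · simp [mergePass]
    · exact mergePass_cons_cons_of_ne _ fun hy => h2 (by simpa using hy.1)
  | cons x φ ih =>
    have ih := ih fun q hq ⟨ψ, ψ', hψ, e⟩ =>
      h (q + 1) (by simpa using hq) ⟨x :: ψ, ψ', by simp [hψ], by simp [e]⟩
    have h0 : ∀ y t, φ ++ r.1 :: r.2 :: φ' = y :: t → ¬ (x = r.1 ∧ y = r.2) :=
      fun y t e hxy => h 0 (by simp) ⟨[], t, rfl, by rw [List.cons_append, e, hxy.1, hxy.2]; rfl⟩
    rcases φ with _ | ⟨y, φ⟩
    · simp only [List.cons_append, List.nil_append] at ih ⊢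
      rw [mergePass_cons_cons_of_ne _ (h0 _ _ rfl), mergePass_cons_cons_of_ne, ih]
      exact fun hy => h1 (by simpa using hy.2)
    · simp only [List.cons_append] at ih ⊢
      rw [mergePass_cons_cons_of_ne _ (h0 _ _ rfl), mergePass_cons_cons_of_ne _ (h0 _ _ rfl), ih]

theorem LeftStep.mergePass_eq (h1 : r.1 ≠ []) (h2 : r.2 ≠ []) {τ τ' : Tok α}
    (h : LeftStep r τ τ') : mergePass r τ' = mergePass r τ := by
  obtain ⟨p, ⟨φ, φ', rfl, rfl⟩, hmin, rfl⟩ := h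
  simpa [applyAt] using mergePass_leftmost_merge h1 h2 φ φ' hmin

theorem LeftStep.length_lt {τ τ' : Tok α} (h : LeftStep r τ τ') : τ'.length < τ.length := by
  obtain ⟨p, ⟨φ, φ', rfl, rfl⟩, -, rfl⟩ := h
  simp [applyAt]

theorem Applies.exists_leftStep {τ : Tok α} (h : Applies r τ) : ∃ τ', LeftStep r τ τ' := by
  classical
  exact ⟨_, Nat.find h, Nat.find_spec h, fun _ hq => Nat.find_min h hq, rfl⟩

theorem exists_exhaust (τ : Tok α) : ∃ τ', Exhaust r τ τ' := by
  by_cases h : Applies r τ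
  · obtain ⟨τ₁, h₁⟩ := h.exists_leftStep
    have := h₁.length_lt
    obtain ⟨τ₂, h₂, hn⟩ := exists_exhaust τ₁
    exact ⟨τ₂, .head h₁ h₂, hn⟩
  · exact ⟨τ, .refl, h⟩
termination_by τ.length

theorem Exhaust.eq_mergePass (h1 : r.1 ≠ []) (h2 : r.2 ≠ []) {τ τ' : Tok α}
    (h : Exhaust r τ τ') : τ' = mergePass r τ := by
  obtain ⟨h, hn⟩ := h
  induction h using Relation.ReflTransGen.head_induction_on with
  | refl => exact (mergePass_of_not_applies hn).symm
  | head hs _ ih => rw [ih, hs.mergePass_eq h1 h2]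

theorem exhaust_iff (h1 : r.1 ≠ []) (h2 : r.2 ≠ []) {τ τ' : Tok α} :
    Exhaust r τ τ' ↔ τ' = mergePass r τ := by
  refine ⟨fun h => h.eq_mergePass h1 h2, ?_⟩
  rintro rfl
  obtain ⟨τ', h⟩ := exists_exhaust (r := r) τ
  exact h.eq_mergePass h1 h2 ▸ h

end MergePass

section Runs

variable {D : Dict α}

/-- `r` is a highest-priority rule of `D` applicable to `τ`. -/
def IsTopRule (D : Dict α) (τ : Tok α) (r : Token α × Token α) : Prop :=
  ∃ (i : ℕ) (h : i < D.length), D[i] = r ∧ Applies r τ ∧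
    ∀ (j : ℕ) (hj : j < D.length), j < i → ¬ Applies D[j] τ

theorem IsTopRule.mem {τ : Tok α} {r : Token α × Token α} (h : IsTopRule D τ r) : r ∈ D := by
  obtain ⟨i, hi, rfl, -⟩ := h
  exact List.getElem_mem hi

theorem IsTopRule.applies {τ : Tok α} {r : Token α × Token α} (h : IsTopRule D τ r) :
    Applies r τ := by
  obtain ⟨_, _, _, h, _⟩ := h
  exact h

theorem IsTopRule.unique {τ : Tok α} {r s : Token α × Token α} (hr : IsTopRule D τ r)
    (hs : IsTopRule D τ s) : r = s := by
  obtain ⟨i, hi, rfl, hia, him⟩ := hr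
  obtain ⟨j, hj, rfl, hja, hjm⟩ := hs
  rcases lt_trichotomy i j with h | rfl | h
  · exact absurd hia (hjm i hi h)
  · rfl
  · exact absurd hja (him j hj h)

theorem IsTopRule.of_infix {τ τ' : Tok α} {r : Token α × Token α} (h : IsTopRule D τ' r)
    (hτ : τ <:+: τ') (hr : Applies r τ) : IsTopRule D τ r := by
  obtain ⟨i, hi, e, -, hm⟩ := h
  exact ⟨i, hi, e, hr, fun j hj hji ha => hm j hj hji (ha.mono hτ)⟩

theorem exists_isTopRule {τ : Tok α} {r : Token α × Token α} (hr : r ∈ D) (h : Applies r τ) :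
    ∃ s, IsTopRule D τ s := by
  classical
  obtain ⟨i, hi, rfl⟩ := List.getElem_of_mem hr
  have hex : ∃ i, ∃ hi : i < D.length, Applies D[i] τ := ⟨i, hi, h⟩
  obtain ⟨hk, hka⟩ := Nat.find_spec hex
  exact ⟨_, Nat.find hex, hk, rfl, hka, fun j hj hjk ha => Nat.find_min hex hjk ⟨hj, ha⟩⟩

theorem hfStep_iff (hD : NEDict D) {τ τ' : Tok α} :
    HFStep D τ τ' ↔ ∃ r, IsTopRule D τ r ∧ τ' = mergePass r τ := by
  constructor
  · rintro ⟨i, hi, ha, hm, he⟩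
    obtain ⟨h1, h2⟩ := hD _ (List.getElem_mem hi)
    exact ⟨_, ⟨i, hi, rfl, ha, hm⟩, he.eq_mergePass h1 h2⟩
  · rintro ⟨r, ⟨i, hi, rfl, ha, hm⟩, he⟩
    obtain ⟨h1, h2⟩ := hD _ (List.getElem_mem hi)
    exact ⟨i, hi, ha, hm, (exhaust_iff h1 h2).2 he⟩

/-- No rule of `D` applies to `τ`. -/
def Irred (D : Dict α) (τ : Tok α) : Prop := ∀ r ∈ D, ¬ Applies r τ

theorem Irred.of_infix {τ τ' : Tok α} (h : Irred D τ') (hτ : τ <:+: τ') : Irred D τ :=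
  fun r hr ha => h r hr (ha.mono hτ)

theorem irred_iff_forall_not_isTopRule {τ : Tok α} : Irred D τ ↔ ∀ r, ¬ IsTopRule D τ r :=
  ⟨fun h r hr => h r hr.mem hr.applies, fun h _ hr ha =>
    let ⟨s, hs⟩ := exists_isTopRule hr ha; h s hs⟩

theorem irred_iff (hD : NEDict D) {τ : Tok α} : Irred D τ ↔ ∀ τ', ¬ HFStep D τ τ' := by
  rw [irred_iff_forall_not_isTopRule]
  refine ⟨fun h τ' hs => ?_, fun h r hr => h _ ((hfStep_iff hD).2 ⟨r, hr, rfl⟩)⟩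
  obtain ⟨r, hr, -⟩ := (hfStep_iff hD).1 hs
  exact h r hr

theorem pi_eq_of_hfSteps (hD : NEDict D) {τ τ' : Tok α}
    (h : Relation.ReflTransGen (HFStep D) τ τ') : pi τ' = pi τ := by
  induction h with
  | refl => rfl
  | tail _ hs ih =>
    obtain ⟨r, -, rfl⟩ := (hfStep_iff hD).1 hs
    rw [pi_mergePass, ih]

/-- The run started at `A ++ B` ends in the irreducible tokenization `P ++ Q`, and no merge
crosses the boundary between the two parts. -/
inductive SplitRun (D : Dict α) (P Q : Tok α) : Tok α → Tok α → Prop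
  | done : Irred D (P ++ Q) → SplitRun D P Q P Q
  | step {A B : Tok α} {r : Token α × Token α} : IsTopRule D (A ++ B) r →
      mergePass r (A ++ B) = mergePass r A ++ mergePass r B →
      SplitRun D P Q (mergePass r A) (mergePass r B) → SplitRun D P Q A B

theorem exists_splitRun (hD : NEDict D) {τ P Q : Tok α}
    (h : Relation.ReflTransGen (HFStep D) τ (P ++ Q)) (hPQ : Irred D (P ++ Q)) :
    ∃ A B, τ = A ++ B ∧ SplitRun D P Q A B := by
  induction h using Relation.ReflTransGen.head_induction_on with
  | refl => exact ⟨P, Q, rfl, .done hPQ⟩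
  | head hs _ ih =>
    obtain ⟨r, hr, rfl⟩ := (hfStep_iff hD).1 hs
    obtain ⟨A', B', e, hrun⟩ := ih
    obtain ⟨A, B, rfl, rfl, rfl⟩ := exists_append_of_mergePass_eq_append e
    exact ⟨A, B, rfl, .step hr e hrun⟩

theorem IsTopRule.hfSteps_mergePass_of_infix (hD : NEDict D) {τ τ' : Tok α}
    {r : Token α × Token α} (h : IsTopRule D τ' r) (hτ : τ <:+: τ') :
    Relation.ReflTransGen (HFStep D) τ (mergePass r τ) := by
  by_cases ha : Applies r τ
  · exact .single ((hfStep_iff hD).2 ⟨r, h.of_infix hτ ha, rfl⟩)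
  · rw [mergePass_of_not_applies ha]

theorem SplitRun.hfSteps (hD : NEDict D) {P Q A B : Tok α} (h : SplitRun D P Q A B) :
    Relation.ReflTransGen (HFStep D) A P ∧ Relation.ReflTransGen (HFStep D) B Q := by
  induction h with
  | done => exact ⟨.refl, .refl⟩
  | step hr _ _ ih =>
    exact ⟨(hr.hfSteps_mergePass_of_infix hD (List.prefix_append _ _).isInfix).trans ih.1,
      (hr.hfSteps_mergePass_of_infix hD (List.suffix_append _ _).isInfix).trans ih.2⟩

theorem SplitRun.of_irred {P Q A B : Tok α} (h : SplitRun D P Q A B) (hAB : Irred D (A ++ B)) :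
    A = P ∧ B = Q := by
  cases h with
  | done => exact ⟨rfl, rfl⟩
  | step hr => exact absurd hr.applies (hAB _ hr.mem)

/-- A split run is compatible with a pass of the top rule of a larger tokenization. -/
theorem SplitRun.mergePass {P Q A B τ : Tok α} {r : Token α × Token α}
    (h : SplitRun D P Q A B) (hr : IsTopRule D τ r) (hAB : A ++ B <:+: τ) :
    mergePass r (A ++ B) = mergePass r A ++ mergePass r B ∧
      SplitRun D P Q (mergePass r A) (mergePass r B) := by
  by_cases ha : Applies r (A ++ B)
  · cases h with
    | done hirr => exact absurd ha (hirr _ hr.mem)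
    | step hs e hrun =>
      obtain rfl := hs.unique (hr.of_infix hAB ha)
      exact ⟨e, hrun⟩
  · rw [mergePass_of_not_applies ha,
      mergePass_of_not_applies fun h => ha (h.mono (List.prefix_append _ _).isInfix),
      mergePass_of_not_applies fun h => ha (h.mono (List.suffix_append _ _).isInfix)]
    exact ⟨rfl, h⟩

theorem SplitRun.glue (hD : NEDict D) {P M Q A U B : Tok α} (hU : U ≠ [])
    (h₁ : SplitRun D P M A U) (h₂ : SplitRun D M Q U B) :
    Relation.ReflTransGen (HFStep D) (A ++ U ++ B) (P ++ M ++ Q) ∧ Irred D (P ++ M ++ Q) := by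
  have hAU : A ++ U <:+: A ++ U ++ B := (List.prefix_append _ _).isInfix
  have hUB : U ++ B <:+: A ++ U ++ B := by
    rw [List.append_assoc]
    exact (List.suffix_append _ _).isInfix
  by_cases hirr : Irred D (A ++ U ++ B)
  · obtain ⟨rfl, rfl⟩ := h₁.of_irred (hirr.of_infix hAU)
    obtain ⟨-, rfl⟩ := h₂.of_irred (hirr.of_infix hUB)
    exact ⟨.refl, hirr⟩
  · obtain ⟨r, hr⟩ : ∃ r, IsTopRule D (A ++ U ++ B) r := by
      simpa [irred_iff_forall_not_isTopRule] using hirr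
    obtain ⟨e₁, h₁'⟩ := h₁.mergePass hr hAU
    obtain ⟨e₂, h₂'⟩ := h₂.mergePass hr hUB
    have e := mergePass_append_append (hD r hr.mem).2 hU e₁ e₂
    have hlt := length_mergePass_lt hr.applies
    obtain ⟨hrun, hfin⟩ := SplitRun.glue hD (mt mergePass_eq_nil.1 hU) h₁' h₂'
    exact ⟨.head ((hfStep_iff hD).2 ⟨r, hr, e.symm⟩) hrun, hfin⟩
termination_by (A ++ U ++ B).length
decreasing_by rwa [← e]

theorem pi_tkEmpty (w : List α) : pi (TkEmpty w) = w := by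
  induction w with
  | nil => rfl
  | cons a w ih => simpa [pi, TkEmpty] using ih

theorem tkEmpty_append (v w : List α) : TkEmpty (v ++ w) = TkEmpty v ++ TkEmpty w :=
  List.map_append

theorem isHF_iff (hD : NEDict D) {w : List α} {τ : Tok α} :
    IsHF D w τ ↔ Relation.ReflTransGen (HFStep D) (TkEmpty w) τ ∧ Irred D τ := by
  rw [irred_iff hD, IsHF]

theorem IsHF.splitRun (hD : NEDict D) {w : List α} {P Q : Tok α} (h : IsHF D w (P ++ Q)) :
    SplitRun D P Q (TkEmpty (pi P)) (TkEmpty (pi Q)) := by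
  obtain ⟨hrun, hirr⟩ := (isHF_iff hD).1 h
  obtain ⟨A, B, e, hs⟩ := exists_splitRun hD hrun hirr
  obtain ⟨a, b, -, rfl, rfl⟩ := List.map_eq_append_iff.1 e
  obtain ⟨hP, hQ⟩ := hs.hfSteps hD
  rw [pi_eq_of_hfSteps hD hP, pi_eq_of_hfSteps hD hQ]
  change SplitRun D P Q (TkEmpty (pi (TkEmpty a))) (TkEmpty (pi (TkEmpty b)))
  rwa [pi_tkEmpty, pi_tkEmpty]

theorem IsHF.left (hD : NEDict D) {w : List α} {P Q : Tok α} (h : IsHF D w (P ++ Q)) :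
    IsHF D (pi P) P :=
  (isHF_iff hD).2 ⟨((h.splitRun hD).hfSteps hD).1,
    ((isHF_iff hD).1 h).2.of_infix (List.prefix_append _ _).isInfix⟩

theorem IsHF.right (hD : NEDict D) {w : List α} {P Q : Tok α} (h : IsHF D w (P ++ Q)) :
    IsHF D (pi Q) Q :=
  (isHF_iff hD).2 ⟨((h.splitRun hD).hfSteps hD).2,
    ((isHF_iff hD).1 h).2.of_infix (List.suffix_append _ _).isInfix⟩

theorem IsHF.glue (hD : NEDict D) {v w : List α} {u : Token α} {P P' Q Q' : Tok α}
    (hv : IsHF D v (P ++ u :: P')) (hw : IsHF D w (Q' ++ u :: Q)) :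
    IsHF D (pi (P ++ u :: Q)) (P ++ u :: Q) := by
  have h₁ : IsHF D _ (P ++ [u]) := IsHF.left hD (Q := P') (by simpa using hv)
  have h₂ : IsHF D _ ([u] ++ Q) := IsHF.right hD hw
  have hu : TkEmpty (pi [u]) ≠ [] := by
    intro hnil
    have hs := ((h₁.splitRun hD).hfSteps hD).2
    rw [hnil] at hs
    obtain h | ⟨_, h, _⟩ := hs.cases_head
    · simp at h
    · obtain ⟨r, hr, -⟩ := (hfStep_iff hD).1 h
      simpa using (applies_iff_infix.1 hr.applies).length_le
  have h := (h₁.splitRun hD).glue hD hu (h₂.splitRun hD)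
  rw [← tkEmpty_append, ← tkEmpty_append] at h
  exact (isHF_iff hD).2 (by simpa [pi] using h)

end Runs

/-- If `𝕋_hf^D(v) = τ₁⌢u⌢τ₂` and `𝕋_hf^D(w) = φ₁⌢u⌢φ₂`, then
`𝕋_hf^D(π(τ₁⌢u⌢φ₂)) = τ₁⌢u⌢φ₂` and `𝕋_hf^D(π(φ₁⌢u⌢τ₂)) = φ₁⌢u⌢τ₂`. -/
theorem hf_glue (D : Dict α) (hD : NEDict D) (v w : List α) (u : Token α)
    (τ₁ τ₂ φ₁ φ₂ : Tok α)
    (h1 : IsHF D v (τ₁ ++ u :: τ₂)) (h2 : IsHF D w (φ₁ ++ u :: φ₂)) :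
    IsHF D (pi (τ₁ ++ u :: φ₂)) (τ₁ ++ u :: φ₂) ∧
      IsHF D (pi (φ₁ ++ u :: τ₂)) (φ₁ ++ u :: τ₂) :=
  ⟨h1.glue hD h2, h2.glue hD h1⟩
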